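/- If m and n are both even integers with 4 ≤ m < n, then W(C_{m,n}) > W(C_{n,m}), i.e., the Wiener index of the comb orientation of the m×n grid strictly exceeds that of the comb orientation of the n×m grid. -/

import Mathlib

/-- Directed distance in a digraph with arc relation `A`: the length of a
shortest directed walk from `u` to `v`, with value `0` if no such walk exists. -/
noncomputable def ddist {V : Type*} (A : V → V → Prop) (u v : V) : ℕ :=
  sInf {k : ℕ | ∃ f : ℕ → V, f 0 = u ∧ f k = v ∧ ∀ i < k, A (f i) (f (i + 1))}

/-- Wiener index of a digraph: the sum of `ddist` over all ordered pairs of vertices. -/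
noncomputable def wiener {V : Type*} [Fintype V] (A : V → V → Prop) : ℕ :=
  ∑ u : V, ∑ v : V, ddist A u v

/-- The comb orientation `C_{m,n}` of the grid `G_{m,n}` (`0`-indexed: vertex `(a, b)`
is the paper's vertex `(a+1, b+1)`, i.e. row `a+1` and column `b+1`). -/
def CombArc (m n : ℕ) (p q : Fin m × Fin n) : Prop :=
  -- horizontal arcs
  (p.1 = q.1 ∧ (
     -- row 1 directed rightward
     ((p.1 : ℕ) = 0 ∧ (q.2 : ℕ) = (p.2 : ℕ) + 1) ∨
     -- row 2: rightward between odd and even columns, leftward between even and odd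
     ((p.1 : ℕ) = 1 ∧ Even (p.2 : ℕ) ∧ (q.2 : ℕ) = (p.2 : ℕ) + 1) ∨
     ((p.1 : ℕ) = 1 ∧ Odd (q.2 : ℕ) ∧ (p.2 : ℕ) = (q.2 : ℕ) + 1) ∨
     -- row m: leftward between odd and even columns, rightward between even and odd
     ((p.1 : ℕ) + 1 = m ∧ Odd (p.2 : ℕ) ∧ (q.2 : ℕ) = (p.2 : ℕ) + 1) ∨
     ((p.1 : ℕ) + 1 = m ∧ Even (q.2 : ℕ) ∧ (p.2 : ℕ) = (q.2 : ℕ) + 1) ∨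
     -- rows 3 … m−1 directed rightward
     (2 ≤ (p.1 : ℕ) ∧ (p.1 : ℕ) + 2 ≤ m ∧ (q.2 : ℕ) = (p.2 : ℕ) + 1))) ∨
  -- vertical arcs
  (p.2 = q.2 ∧ (
     -- column 1 directed upward
     ((p.2 : ℕ) = 0 ∧ (p.1 : ℕ) = (q.1 : ℕ) + 1) ∨
     -- column n directed downward
     ((p.2 : ℕ) + 1 = n ∧ (q.1 : ℕ) = (p.1 : ℕ) + 1) ∨
     -- columns 2 … n−1: the edge between rows 1 and 2 is directed (2,j)→(1,j)
     (1 ≤ (p.2 : ℕ) ∧ (p.2 : ℕ) + 2 ≤ n ∧ (p.1 : ℕ) = 1 ∧ (q.1 : ℕ) = 0) ∨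
     -- odd columns 3 … n−1 directed upward in rows 2 … m
     (1 ≤ (p.2 : ℕ) ∧ (p.2 : ℕ) + 2 ≤ n ∧ Even (p.2 : ℕ) ∧
       2 ≤ (p.1 : ℕ) ∧ (p.1 : ℕ) = (q.1 : ℕ) + 1) ∨
     -- even columns 2 … n−2 directed downward in rows 2 … m
     (1 ≤ (p.2 : ℕ) ∧ (p.2 : ℕ) + 2 ≤ n ∧ Odd (p.2 : ℕ) ∧
       1 ≤ (p.1 : ℕ) ∧ (q.1 : ℕ) = (p.1 : ℕ) + 1)))

/-- A potential that drops by at most one along every arc, and by at least one along some arc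
out of every vertex other than `v`, is the directed distance to `v`. -/
theorem ddist_eq_of_potential {V : Type*} {A : V → V → Prop} {v : V} {φ : V → ℤ}
    (hv : φ v = 0) (hpos : ∀ p, 0 ≤ φ p) (hlip : ∀ p q, A p q → φ p ≤ φ q + 1)
    (hdesc : ∀ p, p ≠ v → ∃ q, A p q ∧ φ q + 1 ≤ φ p) (u : V) :
    (ddist A u v : ℤ) = φ u := by
  have lower : ∀ (k : ℕ) (f : ℕ → V), f k = v → (∀ i < k, A (f i) (f (i + 1))) →
      φ (f 0) ≤ k := by
    intro k
    induction k with
    | zero => intro f hf _; simp [hf, hv]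
    | succ k ih =>
      intro f hf hA
      have h₁ := ih (fun i => f (i + 1)) hf fun i hi => hA (i + 1) (by omega)
      have h₂ := hlip _ _ (hA 0 (by omega))
      push_cast
      simp only [zero_add] at h₁ h₂
      linarith
  have upper : ∀ (N : ℕ) (p : V), φ p ≤ N →
      ∃ k : ℕ, (k : ℤ) ≤ φ p ∧ ∃ f : ℕ → V, f 0 = p ∧ f k = v ∧ ∀ i < k, A (f i) (f (i + 1)) := by
    intro N
    induction N with
    | zero =>
      intro p hp
      by_cases hpv : p = v
      · exact ⟨0, by simpa using hpos p, fun _ => p, rfl, hpv, by simp⟩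
      · obtain ⟨q, -, hq⟩ := hdesc p hpv
        have := hpos q
        push_cast at hp
        linarith
    | succ N ih =>
      intro p hp
      by_cases hpv : p = v
      · exact ⟨0, by simpa using hpos p, fun _ => p, rfl, hpv, by simp⟩
      · obtain ⟨q, hpq, hq⟩ := hdesc p hpv
        obtain ⟨k, hk, f, hf₀, hfk, hf⟩ := ih q (by push_cast at hp; linarith)
        refine ⟨k + 1, by push_cast; linarith, fun i => Nat.casesOn i p f, rfl, hfk, ?_⟩
        intro i hi
        cases i with
        | zero => simpa [hf₀] using hpq
        | succ i => exact hf i (by omega)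
  obtain ⟨k, hk, hf⟩ := upper (φ u).toNat u (Int.self_le_toNat _)
  have hle : ddist A u v ≤ k := Nat.sInf_le hf
  obtain ⟨f, hf₀, hfk, hA⟩ := Nat.sInf_mem (s := {k : ℕ | ∃ f : ℕ → V,
    f 0 = u ∧ f k = v ∧ ∀ i < k, A (f i) (f (i + 1))}) ⟨k, hf⟩
  have hge := lower _ f hfk hA
  rw [hf₀] at hge
  change φ u ≤ (ddist A u v : ℤ) at hge
  have : (ddist A u v : ℤ) ≤ k := by exact_mod_cast hle
  linarith

/-- Position of row `r` within column `c` of the Hamiltonian path that snakes through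
the rows `1, …, m - 1`. -/
def snakeOffset (m r c : ℤ) : ℤ := if c % 2 = 1 then r - 1 else m - 1 - r

/-- Distance from `(r, c)` to `(s, d)` in the `m × n` comb orientation, where `K`, `k`, `l` stand
for the products of `n`, `c`, `d` by `m - 1`. -/
def combDist (m n K r c k s d l : ℤ) : ℤ :=
  if r = 0 then
    if s = 0 then
      if c ≤ d then d - c else n - c + K - (m - 1) - l + snakeOffset m 1 d + 1
    else n - c + K - (m - 1) - l + snakeOffset m s d
  else if s = 0 then
    if c < d then r + d - c
    else if d < c then k - l + snakeOffset m 1 d - snakeOffset m r c + 1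
    else if c % 2 = 0 then r else if c = n - 1 then 2 * m - r else if r = 1 then 1 else r + 2
  else if d < c then k - l + snakeOffset m s d - snakeOffset m r c
  else if c = d then
    if snakeOffset m r c ≤ snakeOffset m s c then snakeOffset m s c - snakeOffset m r c
    else if c = 0 ∨ c = n - 1 then 2 * m - r - s
    else min (r + s) (2 * m - r - s)
  else
    d - c + max (r - s) (s - r) +
      if r = s ∧ ((r = 1 ∧ ¬(c % 2 = 0 ∧ d = c + 1)) ∨ (r = m - 1 ∧ ¬(c % 2 = 1 ∧ d = c + 1)))
      then 2 else 0

/-- The arcs of the comb orientation, in terms of integer coordinates. -/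
def IntCombArc (m n r c r' c' : ℤ) : Prop :=
  (r' = r ∧ c' = c + 1 ∧ (r = 0 ∨ (r = 1 ∧ c % 2 = 0) ∨ (r = m - 1 ∧ c % 2 = 1) ∨
    (2 ≤ r ∧ r ≤ m - 2))) ∨
  (r' = r ∧ c' = c - 1 ∧ ((r = 1 ∧ c % 2 = 0) ∨ (r = m - 1 ∧ c % 2 = 1))) ∨
  (c' = c ∧ r' = r - 1 ∧ (c = 0 ∨ (c ≤ n - 2 ∧ (r = 1 ∨ (2 ≤ r ∧ c % 2 = 0))))) ∨
  (c' = c ∧ r' = r + 1 ∧ (c = n - 1 ∨ (1 ≤ r ∧ c % 2 = 1)))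

theorem combArc_iff {m n : ℕ} (hm : 4 ≤ m) (hn : Even n) (p q : Fin m × Fin n) :
    CombArc m n p q ↔ IntCombArc m n (p.1 : ℕ) (p.2 : ℕ) (q.1 : ℕ) (q.2 : ℕ) := by
  obtain ⟨⟨r, hr⟩, ⟨c, hc⟩⟩ := p
  obtain ⟨⟨r', hr'⟩, ⟨c', hc'⟩⟩ := q
  simp only [CombArc, IntCombArc, Fin.mk.injEq, Nat.even_iff, Nat.odd_iff] at hn ⊢
  constructor
  · intro h
    rcases h with ⟨h, h | h | h | h | h | h⟩ | ⟨h, h | h | h | h | h⟩ <;> omega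
  · intro h
    rcases h with ⟨h, h₁, h₂⟩ | ⟨h, h₁, h₂⟩ | ⟨h, h₁, h₂⟩ | ⟨h, h₁, h₂⟩
    · refine Or.inl ⟨by omega, ?_⟩
      rcases h₂ with h₂ | h₂ | h₂ | h₂ <;> omega
    · refine Or.inl ⟨by omega, ?_⟩
      rcases h₂ with h₂ | h₂ <;> omega
    · refine Or.inr ⟨by omega, ?_⟩
      rcases h₂ with h₂ | ⟨h₂, h₃ | h₃⟩ <;> omega
    · refine Or.inr ⟨by omega, ?_⟩
      rcases h₂ with h₂ | h₂ <;> omega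

theorem combDist_self {m n K r c k : ℤ} : combDist m n K r c k r c k = 0 := by
  unfold combDist
  by_cases hr : r = 0 <;> simp [hr]

theorem combDist_nonneg {m n K r c k s d l : ℤ} (hn : n % 2 = 0)
    (hr₀ : 0 ≤ r) (hr : r ≤ m - 1) (hc : c ≤ n - 1)
    (hs₀ : 0 ≤ s) (hs : s ≤ m - 1)
    (hl : l + (m - 1) ≤ K) (hdc : d < c → l + (m - 1) ≤ k) :
    0 ≤ combDist m n K r c k s d l := by
  unfold combDist snakeOffset
  split_ifs <;> omega

set_option maxHeartbeats 4000000 in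
/-- An arc lowers the distance to a fixed target by at most one. -/
theorem combDist_le_of_arc {m n K r c k r' c' k' s d l : ℤ} (hm : 4 ≤ m) (hn : n % 2 = 0)
    (hr₀ : 0 ≤ r) (hr : r ≤ m - 1) (hc₀ : 0 ≤ c) (hc : c ≤ n - 1)
    (hr'₀ : 0 ≤ r') (hr' : r' ≤ m - 1) (hc'₀ : 0 ≤ c') (hc' : c' ≤ n - 1)
    (hs₀ : 0 ≤ s) (hs : s ≤ m - 1) (hd₀ : 0 ≤ d) (hd : d ≤ n - 1)
    (hl : l + (m - 1) ≤ K) (hl' : d ≤ n - 2 → l + 2 * (m - 1) ≤ K) (hk : k + (m - 1) ≤ K)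
    (hdc : d < c → l + (m - 1) ≤ k) (hkn : c = n - 1 → k = K - (m - 1)) (hcd : c = d → k = l)
    (hcd' : c' = d → k' = l) (hdc' : d < c' → l + (m - 1) ≤ k')
    (hr1 : c' = c + 1 → k' = k + (m - 1)) (hr2 : c' = c - 1 → k' = k - (m - 1))
    (hr3 : c' = c → k' = k)
    (h : IntCombArc m n r c r' c') :
    combDist m n K r c k s d l ≤ combDist m n K r' c' k' s d l + 1 := by
  rcases (by omega : r = 0 ∨ 1 ≤ r) with hr₁ | hr₁
  all_goals rcases (by omega : s = 0 ∨ 1 ≤ s) with hs₁ | hs₁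
  all_goals rcases lt_trichotomy c d with hcd₁ | hcd₁ | hcd₁
  all_goals rcases h with ⟨rfl, rfl, h⟩ | ⟨rfl, rfl, h⟩ | ⟨rfl, rfl, h⟩ | ⟨rfl, rfl, h⟩
  all_goals try omega
  all_goals
    simp (disch := omega) only [combDist, snakeOffset, ↓if_pos, ↓if_neg]
    try split_ifs
  all_goals omega

set_option linter.unusedSimpArgs false in
set_option maxHeartbeats 2000000 in
/-- Moving along some arc decreases `combDist`, unless the target has been reached. -/
theorem exists_arc_combDist_lt {m n K r c k s d l : ℤ} (hm : 4 ≤ m) (hn : n % 2 = 0)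
    (hr₀ : 0 ≤ r) (hr : r ≤ m - 1) (hc₀ : 0 ≤ c) (hc : c ≤ n - 1)
    (hs₀ : 0 ≤ s) (hs : s ≤ m - 1) (hd₀ : 0 ≤ d) (hd : d ≤ n - 1)
    (hkn : c = n - 1 → k = K - (m - 1)) (hcd : c = d → k = l)
    (hdc₁ : d = c - 1 → k = l + (m - 1)) (hdc : d < c → l + (m - 1) ≤ k) (hne : r ≠ s ∨ c ≠ d) :
    ∃ r' c' k' : ℤ, IntCombArc m n r c r' c' ∧ 0 ≤ r' ∧ r' ≤ m - 1 ∧ 0 ≤ c' ∧ c' ≤ n - 1 ∧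
      k' = k + (c' - c) * (m - 1) ∧
      combDist m n K r' c' k' s d l + 1 ≤ combDist m n K r c k s d l := by
  by_contra! H
  have right (h : c ≤ n - 2 ∧
        (r = 0 ∨ (r = 1 ∧ c % 2 = 0) ∨ (r = m - 1 ∧ c % 2 = 1) ∨ (2 ≤ r ∧ r ≤ m - 2))) :
      combDist m n K r c k s d l < combDist m n K r (c + 1) (k + (m - 1)) s d l + 1 :=
    H _ _ _ (Or.inl ⟨rfl, rfl, by omega⟩) (by omega) (by omega) (by omega)
      (by omega) (by ring)
  have left (h : (r = 1 ∧ c % 2 = 0 ∧ 1 ≤ c) ∨ (r = m - 1 ∧ c % 2 = 1)) :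
      combDist m n K r c k s d l < combDist m n K r (c - 1) (k - (m - 1)) s d l + 1 :=
    H _ _ _ (Or.inr (Or.inl ⟨rfl, rfl, by omega⟩)) (by omega) (by omega) (by omega)
      (by omega) (by ring)
  have up (h : c ≤ n - 2 ∧ (r = 1 ∨ (2 ≤ r ∧ c % 2 = 0))) :
      combDist m n K r c k s d l < combDist m n K (r - 1) c k s d l + 1 :=
    H _ _ _ (Or.inr (Or.inr (Or.inl ⟨rfl, rfl, by omega⟩))) (by omega) (by omega) (by omega)
      (by omega) (by ring)
  have down (h : r ≤ m - 2 ∧ (c = n - 1 ∨ (1 ≤ r ∧ c % 2 = 1))) :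
      combDist m n K r c k s d l < combDist m n K (r + 1) c k s d l + 1 :=
    H _ _ _ (Or.inr (Or.inr (Or.inr ⟨rfl, rfl, by omega⟩))) (by omega) (by omega) (by omega)
      (by omega) (by ring)
  clear H
  rcases (by omega : r = 0 ∨ 1 ≤ r) with _ | _
  · rcases (by omega : c ≤ n - 2 ∨ c = n - 1) with _ | _
    · have := right (by omega)
      clear right left up down
      simp (disch := omega) only [combDist, snakeOffset, ↓if_pos, ↓if_neg] at this
      omega
    · have := down (by omega)
      clear right left up down
      simp (disch := omega) only [combDist, snakeOffset, ↓if_pos, ↓if_neg] at this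
      omega
  · rcases (by omega : d < c ∨ c < d ∨ c = d) with _ | _ | _
    · rcases (by omega : c % 2 = 0 ∨ c % 2 = 1) with _ | _
      · rcases (by omega : r = 1 ∨ 2 ≤ r) with _ | _
        · have := left (by omega)
          clear right left up down
          simp (disch := omega) only [combDist, snakeOffset, ↓if_pos, ↓if_neg] at this
          omega
        · have := up (by omega)
          clear right left up down
          simp (disch := omega) only [combDist, snakeOffset, ↓if_pos, ↓if_neg] at this
          omega
      · rcases (by omega : r = m - 1 ∨ r ≤ m - 2) with _ | _
        · have := left (by omega)
          clear right left up down
          simp (disch := omega) only [combDist, snakeOffset, ↓if_pos, ↓if_neg] at this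
          omega
        · have := down (by omega)
          clear right left up down
          simp (disch := omega) only [combDist, snakeOffset, ↓if_pos, ↓if_neg] at this
          omega
    · rcases (by omega : s = 0 ∨ 1 ≤ s) with _ | _
      · rcases (by omega : r = 1 ∨ 2 ≤ r) with _ | _
        · have := up (by omega)
          clear right left up down
          simp (disch := omega) only [combDist, snakeOffset, ↓if_pos, ↓if_neg] at this
          omega
        · rcases (by omega : c % 2 = 0 ∨ c % 2 = 1) with _ | _
          · have := up (by omega)
            clear right left up down
            simp (disch := omega) only [combDist, snakeOffset, ↓if_pos, ↓if_neg] at this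
            omega
          · have := right (by omega)
            clear right left up down
            simp (disch := omega) only [combDist, snakeOffset, ↓if_pos, ↓if_neg] at this
            omega
      · rcases (by omega : c % 2 = 0 ∨ c % 2 = 1) with _ | _
        · rcases (by omega : r = m - 1 ∨ r ≤ m - 2) with _ | _
          · have := up (by omega)
            clear right left up down
            simp (disch := omega) only [combDist, snakeOffset, ↓if_pos, ↓if_neg] at this
            omega
          · rcases (by omega : r ≤ s ∨ s < r) with _ | _
            · have := right (by omega)
              clear right left up down
              simp (disch := omega) only [combDist, snakeOffset, ↓if_pos, ↓if_neg] at this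
              omega
            · rcases (by omega : d = c + 1 ∨ c + 2 ≤ d) with _ | _
              · have := up (by omega)
                clear right left up down
                simp (disch := omega) only [combDist, snakeOffset, ↓if_pos, ↓if_neg] at this
                omega
              · have := right (by omega)
                clear right left up down
                simp (disch := omega) only [combDist, snakeOffset, ↓if_pos, ↓if_neg] at this
                omega
        · rcases (by omega : r = 1 ∨ 2 ≤ r) with _ | _
          · have := down (by omega)
            clear right left up down
            simp (disch := omega) only [combDist, snakeOffset, ↓if_pos, ↓if_neg] at this
            omega
          · rcases (by omega : s ≤ r ∨ r < s) with _ | _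
            · have := right (by omega)
              clear right left up down
              simp (disch := omega) only [combDist, snakeOffset, ↓if_pos, ↓if_neg] at this
              omega
            · rcases (by omega : d = c + 1 ∨ c + 2 ≤ d) with _ | _
              · have := down (by omega)
                clear right left up down
                simp (disch := omega) only [combDist, snakeOffset, ↓if_pos, ↓if_neg] at this
                omega
              · have := right (by omega)
                clear right left up down
                simp (disch := omega) only [combDist, snakeOffset, ↓if_pos, ↓if_neg] at this
                omega
    · rcases (by omega : s = 0 ∨ 1 ≤ s) with _ | _
      · rcases (by omega : c % 2 = 0 ∨ c % 2 = 1) with _ | _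
        · have := up (by omega)
          clear right left up down
          simp (disch := omega) only [combDist, snakeOffset, ↓if_pos, ↓if_neg] at this
          omega
        · rcases (by omega : c = n - 1 ∨ c ≤ n - 2) with _ | _
          · rcases (by omega : r = m - 1 ∨ r ≤ m - 2) with _ | _
            · have := left (by omega)
              clear right left up down
              simp (disch := omega) only [combDist, snakeOffset, ↓if_pos, ↓if_neg] at this
              omega
            · have := down (by omega)
              clear right left up down
              simp (disch := omega) only [combDist, snakeOffset, ↓if_pos, ↓if_neg] at this
              omega
          · rcases (by omega : r = 1 ∨ 2 ≤ r) with _ | _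
            · have := up (by omega)
              clear right left up down
              simp (disch := omega) only [combDist, snakeOffset, ↓if_pos, ↓if_neg] at this
              omega
            · have := right (by omega)
              clear right left up down
              simp (disch := omega) only [combDist, snakeOffset, ↓if_pos, ↓if_neg] at this
              omega
      · rcases (by omega : c % 2 = 0 ∨ c % 2 = 1) with _ | _
        · rcases (by omega : s < r ∨ r < s) with _ | _
          · have := up (by omega)
            clear right left up down
            simp (disch := omega) only [combDist, snakeOffset, ↓if_pos, ↓if_neg] at this
            omega
          · rcases (by omega : c = 0 ∨ 1 ≤ c) with _ | _
            · have := right (by omega)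
              clear right left up down
              simp (disch := omega) only [combDist, snakeOffset, ↓if_pos, ↓if_neg] at this
              omega
            · rcases (by omega : m < r + s ∨ r + s ≤ m) with _ | _
              · have := right (by omega)
                clear right left up down
                simp (disch := omega) only [combDist, snakeOffset, ↓if_pos, ↓if_neg] at this
                omega
              · rcases (by omega : r = 1 ∨ 2 ≤ r) with _ | _
                · have := left (by omega)
                  clear right left up down
                  simp (disch := omega) only [combDist, snakeOffset, ↓if_pos, ↓if_neg] at this
                  omega
                · have := up (by omega)
                  clear right left up down
                  simp (disch := omega) only [combDist, snakeOffset, ↓if_pos, ↓if_neg] at this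
                  omega
        · rcases (by omega : r < s ∨ s < r) with _ | _
          · have := down (by omega)
            clear right left up down
            simp (disch := omega) only [combDist, snakeOffset, ↓if_pos, ↓if_neg] at this
            omega
          · rcases (by omega : c = n - 1 ∨ c ≤ n - 2) with _ | _
            · rcases (by omega : r = m - 1 ∨ r ≤ m - 2) with _ | _
              · have := left (by omega)
                clear right left up down
                simp (disch := omega) only [combDist, snakeOffset, ↓if_pos, ↓if_neg] at this
                omega
              · have := down (by omega)
                clear right left up down
                simp (disch := omega) only [combDist, snakeOffset, ↓if_pos, ↓if_neg] at this
                omega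
            · rcases (by omega : r + s ≤ m ∨ m < r + s) with _ | _
              · have := right (by omega)
                clear right left up down
                simp (disch := omega) only [combDist, snakeOffset, ↓if_pos, ↓if_neg] at this
                omega
              · rcases (by omega : r = m - 1 ∨ r ≤ m - 2) with _ | _
                · have := left (by omega)
                  clear right left up down
                  simp (disch := omega) only [combDist, snakeOffset, ↓if_pos, ↓if_neg] at this
                  omega
                · have := down (by omega)
                  clear right left up down
                  simp (disch := omega) only [combDist, snakeOffset, ↓if_pos, ↓if_neg] at this
                  omega

theorem ddist_combArc {m n : ℕ} (hm : 4 ≤ m) (hn : Even n) (p v : Fin m × Fin n) :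
    (ddist (CombArc m n) p v : ℤ) =
      combDist m n (n * (m - 1)) (p.1 : ℕ) (p.2 : ℕ) ((p.2 : ℕ) * (m - 1))
        (v.1 : ℕ) (v.2 : ℕ) ((v.2 : ℕ) * (m - 1)) := by
  have hn₂ : (n : ℤ) % 2 = 0 := by rw [Nat.even_iff] at hn; omega
  have hm₀ : (0 : ℤ) ≤ m - 1 := by omega
  have hgap (a b e : ℤ) (h : a + e ≤ b) : a * ((m : ℤ) - 1) + e * (m - 1) ≤ b * (m - 1) := by
    rw [← add_mul]; exact mul_le_mul_of_nonneg_right h hm₀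
  have hgap₁ (a b : ℤ) (h : a + 1 ≤ b) : a * ((m : ℤ) - 1) + (m - 1) ≤ b * (m - 1) := by
    simpa using hgap a b 1 h
  have hbound (q : Fin m × Fin n) : (0 : ℤ) ≤ (q.1 : ℕ) ∧ ((q.1 : ℕ) : ℤ) ≤ m - 1 ∧
      (0 : ℤ) ≤ (q.2 : ℕ) ∧ ((q.2 : ℕ) : ℤ) ≤ n - 1 := by
    have := q.1.isLt
    have := q.2.isLt
    omega
  refine ddist_eq_of_potential (φ := fun p => combDist m n (n * (m - 1)) (p.1 : ℕ) (p.2 : ℕ)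
    ((p.2 : ℕ) * (m - 1)) (v.1 : ℕ) (v.2 : ℕ) ((v.2 : ℕ) * (m - 1))) combDist_self ?_ ?_ ?_ p
  · intro p
    obtain ⟨hr₀, hr, hc₀, hc⟩ := hbound p
    obtain ⟨hs₀, hs, hd₀, hd⟩ := hbound v
    exact combDist_nonneg hn₂ hr₀ hr hc hs₀ hs (hgap₁ _ _ (by omega))
      fun h => hgap₁ _ _ (by omega)
  · intro p q hpq
    obtain ⟨hr₀, hr, hc₀, hc⟩ := hbound p
    obtain ⟨hr'₀, hr', hc'₀, hc'⟩ := hbound q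
    obtain ⟨hs₀, hs, hd₀, hd⟩ := hbound v
    exact combDist_le_of_arc (by omega) hn₂ hr₀ hr hc₀ hc hr'₀ hr' hc'₀ hc' hs₀ hs hd₀ hd
      (hgap₁ _ _ (by omega)) (fun h => hgap _ _ 2 (by omega)) (hgap₁ _ _ (by omega))
      (fun h => hgap₁ _ _ (by omega)) (fun h => by rw [h]; ring) (fun h => by rw [h])
      (fun h => by rw [h]) (fun h => hgap₁ _ _ (by omega)) (fun h => by rw [h]; ring)
      (fun h => by rw [h]; ring) (fun h => by rw [h]) ((combArc_iff hm hn p q).1 hpq)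
  · intro p hpv
    obtain ⟨hr₀, hr, hc₀, hc⟩ := hbound p
    obtain ⟨hs₀, hs, hd₀, hd⟩ := hbound v
    have hne : ((p.1 : ℕ) : ℤ) ≠ (v.1 : ℕ) ∨ ((p.2 : ℕ) : ℤ) ≠ (v.2 : ℕ) := by
      by_contra! h
      exact hpv (Prod.ext (Fin.ext (by exact_mod_cast h.1)) (Fin.ext (by exact_mod_cast h.2)))
    obtain ⟨r', c', k', harc, h₁, h₂, h₃, h₄, rfl, hlt⟩ :=
      exists_arc_combDist_lt (m := m) (n := n) (K := n * (m - 1)) (k := (p.2 : ℕ) * (m - 1))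
        (l := (v.2 : ℕ) * (m - 1)) (by omega) hn₂ hr₀ hr hc₀ hc hs₀ hs hd₀ hd
        (fun h => by rw [h]; ring) (fun h => by rw [h]) (fun h => by rw [h]; ring)
        (fun h => hgap₁ _ _ (by omega)) hne
    lift r' to ℕ using h₁
    lift c' to ℕ using h₃
    refine ⟨(⟨r', by omega⟩, ⟨c', by omega⟩), (combArc_iff hm hn _ _).2 harc, ?_⟩
    convert hlt using 3
    ring

/-- Distances in the comb orientation with `M + 1` rows and `n` columns, as rational numbers. -/
def ratCombDist (M n r c s d : ℕ) : ℚ :=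
  (combDist (M + 1) n (n * M) r c (c * M) s d (d * M) : ℤ)

theorem wiener_combArc_eq_sum {M n : ℕ} (hM : 3 ≤ M) (hn : Even n) :
    (wiener (CombArc (M + 1) n) : ℚ) = ∑ c ∈ Finset.range n, ∑ d ∈ Finset.range n,
      (∑ i ∈ Finset.range M, ∑ j ∈ Finset.range M, ratCombDist M n (i + 1) c (j + 1) d +
        ∑ i ∈ Finset.range M, ratCombDist M n (i + 1) c 0 d +
        ∑ j ∈ Finset.range M, ratCombDist M n 0 c (j + 1) d + ratCombDist M n 0 c 0 d) := by
  have hdist (p v : Fin (M + 1) × Fin n) : (ddist (CombArc (M + 1) n) p v : ℚ) =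
      ratCombDist M n p.1 p.2 v.1 v.2 := by
    have h := ddist_combArc (by omega) hn p v
    push_cast at h
    rw [add_sub_cancel_right] at h
    rw [ratCombDist, ← h]
    norm_cast
  have hfin : (wiener (CombArc (M + 1) n) : ℚ) =
      ∑ r : Fin (M + 1), ∑ c : Fin n, ∑ s : Fin (M + 1), ∑ d : Fin n,
        ratCombDist M n r c s d := by
    simp only [wiener, Nat.cast_sum, hdist, Fintype.sum_prod_type]
  rw [hfin]
  simp only [Finset.sum_range]
  rw [Finset.sum_comm]
  refine Finset.sum_congr rfl fun c _ => ?_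
  simp only [Finset.sum_comm (s := (Finset.univ : Finset (Fin (M + 1))))
    (t := (Finset.univ : Finset (Fin n)))]
  refine Finset.sum_congr rfl fun d _ => ?_
  simp only [Fin.sum_univ_succ, Fin.val_zero, Fin.val_succ, Finset.sum_add_distrib]
  ring

theorem sum_range_eq_of_succ {f g : ℕ → ℚ} (h₀ : g 0 = 0) (h : ∀ i, g (i + 1) = g i + f i)
    (N : ℕ) : ∑ i ∈ Finset.range N, f i = g N := by
  induction N with
  | zero => simp [h₀]
  | succ N ih => rw [Finset.sum_range_succ, ih, h]

theorem sum_range_sum_range_eq (f : ℕ → ℕ → ℚ) (N : ℕ) :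
    ∑ i ∈ Finset.range N, ∑ j ∈ Finset.range N, f i j =
      ∑ i ∈ Finset.range N, (f i i + ∑ j ∈ Finset.range i, (f i j + f j i)) := by
  induction N with
  | zero => simp
  | succ N ih =>
    rw [Finset.sum_range_succ (fun i => f i i + ∑ j ∈ Finset.range i, (f i j + f j i)), ← ih]
    simp only [Finset.sum_range_succ _ N, Finset.sum_add_distrib]
    ring

theorem sum_range_cast (N : ℕ) : ∑ i ∈ Finset.range N, (i : ℚ) = N * (N - 1) / 2 :=
  sum_range_eq_of_succ (g := fun N => (N : ℚ) * (N - 1) / 2) (by simp)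
    (fun i => by push_cast; ring) N

theorem sum_range_abs_sub (N : ℕ) :
    ∑ i ∈ Finset.range N, ∑ j ∈ Finset.range N, |(i : ℚ) - j| = N * (N ^ 2 - 1) / 3 := by
  rw [sum_range_sum_range_eq]
  have hin (i : ℕ) : |(i : ℚ) - i| + ∑ j ∈ Finset.range i, (|(i : ℚ) - j| + |(j : ℚ) - i|) =
      i * (i + 1) := by
    have hj : ∀ j ∈ Finset.range i, |(i : ℚ) - j| + |(j : ℚ) - i| = 2 * (i - j) := by
      intro j hj
      have : (j : ℚ) ≤ i := by exact_mod_cast (Finset.mem_range.1 hj).le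
      rw [abs_of_nonneg (by linarith), abs_of_nonpos (by linarith)]
      ring
    rw [Finset.sum_congr rfl hj, ← Finset.mul_sum, Finset.sum_sub_distrib, sum_range_cast]
    simp
    ring
  simp only [hin]
  exact sum_range_eq_of_succ (g := fun N => (N : ℚ) * (N ^ 2 - 1) / 3) (by simp)
    (fun i => by push_cast; ring) N

theorem sum_range_abs_sub_add (M : ℕ) :
    ∑ i ∈ Finset.range M, ∑ j ∈ Finset.range M, |(M : ℚ) - 1 - i - j| = M * (M ^ 2 - 1) / 3 := by
  rw [← sum_range_abs_sub]
  refine Finset.sum_congr rfl fun i _ => ?_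
  rw [← Finset.sum_range_reflect]
  refine Finset.sum_congr rfl fun j hj => ?_
  have hj := Finset.mem_range.1 hj
  rw [Nat.cast_sub (by omega), Nat.cast_sub (by omega), abs_sub_comm]
  push_cast
  ring_nf

theorem sum_range_abs_sub_two_mul (a : ℕ) :
    ∑ i ∈ Finset.range (2 * a + 1), |2 * (a : ℚ) - 2 * i| = 2 * a * (a + 1) := by
  induction a with
  | zero => simp
  | succ a ih =>
    rw [show 2 * (a + 1) + 1 = (2 * a + 1) + 1 + 1 by ring, Finset.sum_range_succ,
      Finset.sum_range_succ']
    have hshift : ∀ i : ℕ, |2 * ((a + 1 : ℕ) : ℚ) - 2 * ((i + 1 : ℕ) : ℚ)| =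
        |2 * (a : ℚ) - 2 * i| := by
      intro i; congr 1; push_cast; ring
    simp only [hshift, ih]
    have ha := Nat.cast_nonneg (α := ℚ) a
    rw [abs_of_nonneg (a := _ - 2 * ((0 : ℕ) : ℚ)) (by push_cast; linarith),
      abs_of_nonpos (by push_cast; linarith)]
    push_cast
    ring

theorem snakeOffset_one (M d : ℕ) :
    ((snakeOffset (M + 1) 1 d : ℤ) : ℚ) = (M - 1) * (1 + (-1) ^ d) / 2 := by
  rcases Nat.even_or_odd d with h | h
  · rw [h.neg_one_pow, snakeOffset, if_neg (by rw [Nat.even_iff] at h; omega)]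
    push_cast
    ring
  · rw [h.neg_one_pow, snakeOffset, if_pos (by rw [Nat.odd_iff] at h; omega)]
    push_cast
    ring

theorem sum_snakeOffset (M c : ℕ) :
    ∑ i ∈ Finset.range M, ((snakeOffset (M + 1) (i + 1) c : ℤ) : ℚ) = M * (M - 1) / 2 := by
  unfold snakeOffset
  split_ifs
  · simp [sum_range_cast]
  · simp only [add_sub_cancel_right, Int.cast_sub, Int.cast_add, Int.cast_natCast, Int.cast_one,
      Finset.sum_sub_distrib, Finset.sum_add_distrib, sum_range_cast, Finset.sum_const,
      Finset.card_range, nsmul_eq_mul]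
    ring

theorem ratCombDist_zero_succ (M n c j d : ℕ) :
    ratCombDist M n 0 c (j + 1) d =
      n - c + (n - 1 - d) * M + (snakeOffset (M + 1) (j + 1) d : ℤ) := by
  have hj : (j : ℤ) + 1 ≠ 0 := by omega
  simp only [ratCombDist, combDist, Nat.cast_zero, Nat.cast_add, Nat.cast_one, if_true, if_neg hj,
    add_sub_cancel_right]
  push_cast
  ring

theorem sum_ratCombDist_zero_succ (M n c d : ℕ) :
    ∑ j ∈ Finset.range M, ratCombDist M n 0 c (j + 1) d =
      M * (n - c + (n - 1 - d) * M) + M * (M - 1) / 2 := by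
  simp only [ratCombDist_zero_succ, Finset.sum_add_distrib, sum_snakeOffset, Finset.sum_const,
    Finset.card_range, nsmul_eq_mul]
  ring

theorem ratCombDist_zero_zero_of_le {M n c d : ℕ} (h : c ≤ d) :
    ratCombDist M n 0 c 0 d = d - c := by
  simp [ratCombDist, combDist, h]

theorem ratCombDist_zero_zero_of_lt {M n c d : ℕ} (h : d < c) :
    ratCombDist M n 0 c 0 d =
      n - c + (n - 1 - d) * M + (M - 1) * (1 + (-1) ^ d) / 2 + 1 := by
  have hc : ¬(c : ℤ) ≤ d := by omega
  simp only [ratCombDist, combDist, Nat.cast_zero, if_true, if_neg hc, add_sub_cancel_right]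
  push_cast
  rw [snakeOffset_one]
  ring

theorem sum_ratCombDist_succ_zero_of_lt {M n c d : ℕ} (h : d < c) :
    ∑ i ∈ Finset.range M, ratCombDist M n (i + 1) c 0 d =
      M * ((c - d) * M + (M - 1) * (1 + (-1) ^ d) / 2 + 1) - M * (M - 1) / 2 := by
  have hpt (i : ℕ) : ratCombDist M n (i + 1) c 0 d =
      ((c - d) * M + (M - 1) * (1 + (-1) ^ d) / 2 + 1) -
        (snakeOffset (M + 1) (i + 1) c : ℤ) := by
    have hi : (i : ℤ) + 1 ≠ 0 := by omega
    have hcd : ¬(c : ℤ) < d := by omega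
    have hdc : (d : ℤ) < c := by omega
    simp only [ratCombDist, combDist, Nat.cast_zero, Nat.cast_add, Nat.cast_one, if_true,
      if_neg hi, if_neg hcd, if_pos hdc]
    push_cast
    rw [snakeOffset_one]
    ring
  simp only [hpt, Finset.sum_sub_distrib, sum_snakeOffset, Finset.sum_const, Finset.card_range,
    nsmul_eq_mul]

theorem sum_ratCombDist_succ_succ_of_lt {M n c d : ℕ} (h : d < c) :
    ∑ i ∈ Finset.range M, ∑ j ∈ Finset.range M, ratCombDist M n (i + 1) c (j + 1) d =
      M ^ 3 * (c - d) := by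
  have hpt (i j : ℕ) : ratCombDist M n (i + 1) c (j + 1) d = (c - d) * M +
      (snakeOffset (M + 1) (j + 1) d : ℤ) - (snakeOffset (M + 1) (i + 1) c : ℤ) := by
    have hi : (i : ℤ) + 1 ≠ 0 := by omega
    have hj : (j : ℤ) + 1 ≠ 0 := by omega
    have hdc : (d : ℤ) < c := by omega
    simp only [ratCombDist, combDist, Nat.cast_add, Nat.cast_one, if_neg hi, if_neg hj, if_pos hdc]
    push_cast
    ring
  simp only [hpt, Finset.sum_sub_distrib, Finset.sum_add_distrib, sum_snakeOffset, Finset.sum_const,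
    Finset.card_range, nsmul_eq_mul, ← Finset.mul_sum]
  ring

theorem sum_ratCombDist_succ_zero_of_gt {M n c d : ℕ} (h : c < d) :
    ∑ i ∈ Finset.range M, ratCombDist M n (i + 1) c 0 d =
      M * (M + 1) / 2 + M * (d - c) := by
  have hpt (i : ℕ) : ratCombDist M n (i + 1) c 0 d = i + (1 + (d - c)) := by
    have hi : (i : ℤ) + 1 ≠ 0 := by omega
    have hcd : (c : ℤ) < d := by omega
    simp only [ratCombDist, combDist, Nat.cast_zero, Nat.cast_add, Nat.cast_one, if_true,
      if_neg hi, if_pos hcd]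
    push_cast
    ring
  simp only [hpt, Finset.sum_add_distrib, sum_range_cast, Finset.sum_const, Finset.card_range,
    nsmul_eq_mul]
  ring

theorem sum_ratCombDist_succ_succ_of_gt {M n c d : ℕ} (hM : 2 ≤ M) (h : c < d) :
    ∑ i ∈ Finset.range M, ∑ j ∈ Finset.range M, ratCombDist M n (i + 1) c (j + 1) d =
      M ^ 2 * (d - c) + M * (M ^ 2 - 1) / 3 + 4 - if d = c + 1 then 2 else 0 := by
  have hpt (i j : ℕ) : ratCombDist M n (i + 1) c (j + 1) d = (d - c) + |(i : ℚ) - j| +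
      if i = j then (if i = 0 then (if c % 2 = 0 ∧ d = c + 1 then 0 else 2) else 0) +
        (if i = M - 1 then (if c % 2 = 1 ∧ d = c + 1 then 0 else 2) else 0) else 0 := by
    have hi : (i : ℤ) + 1 ≠ 0 := by omega
    have hj : (j : ℤ) + 1 ≠ 0 := by omega
    have hdc : ¬(d : ℤ) < c := by omega
    have hcd : (c : ℤ) ≠ d := by omega
    have habs : max ((i : ℤ) + 1 - (j + 1)) (j + 1 - (i + 1)) = |(i : ℤ) - j| := by
      rw [abs_eq_max_neg]; congr 1 <;> ring
    have hex : (if (i : ℤ) + 1 = j + 1 ∧ (((i : ℤ) + 1 = 1 ∧ ¬((c : ℤ) % 2 = 0 ∧ (d : ℤ) = c + 1)) ∨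
        ((i : ℤ) + 1 = M + 1 - 1 ∧ ¬((c : ℤ) % 2 = 1 ∧ (d : ℤ) = c + 1))) then (2 : ℤ) else 0) =
        if i = j then (if i = 0 then (if c % 2 = 0 ∧ d = c + 1 then 0 else 2) else 0) +
        (if i = M - 1 then (if c % 2 = 1 ∧ d = c + 1 then 0 else 2) else 0) else 0 := by
      split_ifs <;> omega
    simp only [ratCombDist, combDist, Nat.cast_add, Nat.cast_one, if_neg hi, if_neg hj, if_neg hdc,
      if_neg hcd, habs, hex]
    push_cast
    ring
  have hex : ∑ i ∈ Finset.range M,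
      ((if i = 0 then (if c % 2 = 0 ∧ d = c + 1 then 0 else 2) else 0) +
        (if i = M - 1 then (if c % 2 = 1 ∧ d = c + 1 then 0 else 2) else 0)) =
      4 - if d = c + 1 then (2 : ℚ) else 0 := by
    rw [Finset.sum_add_distrib, Finset.sum_ite_eq', Finset.sum_ite_eq',
      if_pos (Finset.mem_range.2 (by omega)), if_pos (Finset.mem_range.2 (by omega))]
    rcases Nat.mod_two_eq_zero_or_one c with hc | hc <;> by_cases hd : d = c + 1 <;>
      norm_num [hc, hd]
  have hdiag : ∑ i ∈ Finset.range M, ∑ j ∈ Finset.range M,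
      (if i = j then (if i = 0 then (if c % 2 = 0 ∧ d = c + 1 then 0 else 2) else 0) +
        (if i = M - 1 then (if c % 2 = 1 ∧ d = c + 1 then 0 else 2) else 0) else 0) =
      4 - if d = c + 1 then (2 : ℚ) else 0 := by
    rw [← hex]
    refine Finset.sum_congr rfl fun i hi => ?_
    rw [Finset.sum_ite_eq, if_pos hi]
  simp only [hpt, Finset.sum_add_distrib] at hdiag ⊢
  rw [hdiag, sum_range_abs_sub]
  simp only [Finset.sum_const, Finset.card_range, nsmul_eq_mul]
  ring

theorem sum_ratCombDist_succ_zero_self {M n c : ℕ} (hM : 1 ≤ M) (hn : Even n) (hc : c < n) :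
    ∑ i ∈ Finset.range M, ratCombDist M n (i + 1) c 0 c =
      M * (M + 1) / 2 + (M - 1) * (1 - (-1) ^ c) +
        if c = n - 1 then (M : ℚ) * (M + 1) - 2 * (M - 1) else 0 := by
  have hpt (i : ℕ) : ratCombDist M n (i + 1) c 0 c =
      if c % 2 = 0 then (i : ℚ) + 1 else if c = n - 1 then 2 * (M + 1) - (i + 1)
        else i + 3 - if i = 0 then 2 else 0 := by
    have hi : (i : ℤ) + 1 ≠ 0 := by omega
    have hval : combDist (M + 1) n (n * M) ((i : ℤ) + 1) c (c * M) 0 c (c * M) =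
        if c % 2 = 0 then (i : ℤ) + 1 else if c = n - 1 then 2 * (M + 1) - (i + 1)
          else i + 3 - if i = 0 then 2 else 0 := by
      simp only [combDist, if_true, if_neg hi, lt_irrefl, if_false]
      split_ifs <;> omega
    rw [ratCombDist]
    push_cast
    rw [hval]
    push_cast
    rfl
  have hn₂ := Nat.even_iff.1 hn
  simp only [hpt]
  rcases Nat.even_or_odd c with h | h
  · have h₂ := Nat.even_iff.1 h
    rw [h.neg_one_pow, if_neg (show ¬c = n - 1 by omega)]
    simp only [if_pos h₂, Finset.sum_add_distrib, sum_range_cast, Finset.sum_const,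
      Finset.card_range, nsmul_eq_mul]
    ring
  · have h₂ : ¬c % 2 = 0 := by rw [Nat.odd_iff] at h; omega
    rw [h.neg_one_pow]
    simp only [if_neg h₂]
    split_ifs
    · simp only [Finset.sum_add_distrib, Finset.sum_sub_distrib, sum_range_cast, Finset.sum_const,
        Finset.card_range, nsmul_eq_mul]
      ring
    · simp only [Finset.sum_add_distrib, Finset.sum_sub_distrib, sum_range_cast, Finset.sum_const,
        Finset.card_range, nsmul_eq_mul, Finset.sum_ite_eq',
        if_pos (Finset.mem_range.2 (show 0 < M by omega))]
      ring

/-- The sum of the distances within column `c`, excluding row `0`. -/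
theorem sum_ratCombDist_succ_succ_self {M a n c : ℕ} (hM : M = 2 * a + 1) :
    ∑ i ∈ Finset.range M, ∑ j ∈ Finset.range M, ratCombDist M n (i + 1) c (j + 1) c =
      if c = 0 ∨ c + 1 = n then
        (M * (M ^ 2 - 1) / 3 + M ^ 3 + M ^ 2) / 2 - M ^ 2 + (M : ℚ) * (M - 1) / 2
      else (((M : ℚ) + 1) * M ^ 2 - M * (M + 1) + 2 * a * (a + 1)) / 2 := by
  have hsymm (i j : ℕ) :
      ratCombDist M n (i + 1) c (j + 1) c + ratCombDist M n (j + 1) c (i + 1) c =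
      |(i : ℚ) - j| + (if c = 0 ∨ c + 1 = n then 2 * (M : ℚ) - i - j
          else M + 1 - |(M : ℚ) - 1 - i - j|) -
        if i = j then (if c = 0 ∨ c + 1 = n then 2 * (M : ℚ) - i - j
          else M + 1 - |(M : ℚ) - 1 - i - j|) else 0 := by
    have hi : (i : ℤ) + 1 ≠ 0 := by omega
    have hj : (j : ℤ) + 1 ≠ 0 := by omega
    have hends : ((c : ℤ) = 0 ∨ (c : ℤ) = n - 1) ↔ (c = 0 ∨ c + 1 = n) := by omega
    have hval : combDist (M + 1) n (n * M) ((i : ℤ) + 1) c (c * M) (j + 1) c (c * M) +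
        combDist (M + 1) n (n * M) ((j : ℤ) + 1) c (c * M) (i + 1) c (c * M) =
        |(i : ℤ) - j| + (if c = 0 ∨ c + 1 = n then 2 * (M : ℤ) - i - j
          else M + 1 - |(M : ℤ) - 1 - i - j|) -
        if i = j then (if c = 0 ∨ c + 1 = n then 2 * (M : ℤ) - i - j
          else M + 1 - |(M : ℤ) - 1 - i - j|) else 0 := by
      simp only [combDist, snakeOffset, if_true, if_neg hi, if_neg hj, lt_irrefl, if_false, hends,
        abs_eq_max_neg]
      split_ifs <;> omega
    have hcast := congrArg (Int.cast : ℤ → ℚ) hval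
    push_cast at hcast
    rw [ratCombDist, ratCombDist]
    push_cast
    exact hcast
  have hhalf : ∑ i ∈ Finset.range M, ∑ j ∈ Finset.range M, ratCombDist M n (i + 1) c (j + 1) c =
      (∑ i ∈ Finset.range M, ∑ j ∈ Finset.range M,
        (ratCombDist M n (i + 1) c (j + 1) c + ratCombDist M n (j + 1) c (i + 1) c)) / 2 := by
    simp only [Finset.sum_add_distrib]
    rw [Finset.sum_comm (f := fun i j => ratCombDist M n (j + 1) c (i + 1) c)]
    ring
  have hdiag (f : ℕ → ℕ → ℚ) : ∑ i ∈ Finset.range M, ∑ j ∈ Finset.range M,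
      (if i = j then f i j else 0) = ∑ i ∈ Finset.range M, f i i := by
    refine Finset.sum_congr rfl fun i hi => ?_
    rw [Finset.sum_ite_eq, if_pos hi]
  rw [hhalf]
  simp only [hsymm, Finset.sum_sub_distrib, Finset.sum_add_distrib, hdiag, sum_range_abs_sub]
  split_ifs
  · simp only [Finset.sum_sub_distrib, sum_range_cast, Finset.sum_const, Finset.card_range,
      nsmul_eq_mul, ← Finset.mul_sum]
    ring
  · have habs : ∑ i ∈ Finset.range M, |(M : ℚ) - 1 - i - i| = 2 * a * (a + 1) := by
      rw [← sum_range_abs_sub_two_mul, hM]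
      refine Finset.sum_congr rfl fun i _ => ?_
      congr 1
      push_cast
      ring
    simp only [Finset.sum_sub_distrib, Finset.sum_add_distrib, sum_range_abs_sub_add, habs,
      Finset.sum_const, Finset.card_range, nsmul_eq_mul]
    ring

theorem sum_range_neg_one_pow (N : ℕ) :
    ∑ i ∈ Finset.range N, (-1 : ℚ) ^ i = (1 - (-1) ^ N) / 2 :=
  sum_range_eq_of_succ (g := fun N => (1 - (-1 : ℚ) ^ N) / 2) (by simp)
    (fun i => by rw [pow_succ]; ring) N

theorem sum_range_sum_range_lt (A B C E : ℚ) (N : ℕ) :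
    ∑ c ∈ Finset.range (N + 1), ∑ d ∈ Finset.range c,
      (A + B * c + C * d + E * (-1) ^ d - if c = d + 1 then 2 else 0) =
    A * (N * (N + 1) / 2) + B * (N * (N + 1) * (2 * N + 1) / 6) + C * ((N + 1) * N * (N - 1) / 6) +
      E * ((N + 1) / 2 - (1 - (-1) ^ (N + 1)) / 4) - 2 * N := by
  have hin (c : ℕ) : ∑ d ∈ Finset.range (c + 1),
      (A + B * (c + 1 : ℕ) + C * d + E * (-1) ^ d - if c + 1 = d + 1 then 2 else 0) =
      A * (c + 1) + B * (c + 1) ^ 2 + C * ((c + 1) * c / 2) +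
        E * ((1 - (-1) ^ (c + 1)) / 2) - 2 := by
    simp only [Finset.sum_sub_distrib, Finset.sum_add_distrib, ← Finset.mul_sum, sum_range_cast,
      sum_range_neg_one_pow, Finset.sum_const, Finset.card_range, nsmul_eq_mul, add_left_inj,
      Finset.sum_ite_eq, if_pos (Finset.self_mem_range_succ c)]
    push_cast
    ring
  induction N with
  | zero => simp; norm_num
  | succ N ih =>
    rw [Finset.sum_range_succ, ih, hin]
    push_cast
    rw [pow_succ _ (N + 1)]
    ring

/-- Closed form of the Wiener index of the comb orientation of the `m × n` grid. -/
theorem wiener_combArc_eq {m n : ℕ} (hm : Even m) (hne : Even n) (hm4 : 4 ≤ m) (hn1 : 1 ≤ n) :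
    (wiener (CombArc m n) : ℚ) =
      (36 - 36 * n + 12 * n ^ 2 - 8 * m - m * n + 2 * m * n ^ 2 - m * n ^ 3 - 3 * m ^ 2 -
        m ^ 2 * n / 2 - 3 * m ^ 2 * n ^ 2 / 2 + 2 * m ^ 2 * n ^ 3 + 2 * m ^ 3 + m ^ 3 * n +
        m ^ 3 * n ^ 2 + m ^ 3 * n ^ 3) / 6 := by
  obtain ⟨k, rfl⟩ := hm
  obtain ⟨a, rfl⟩ : ∃ a, k = a + 1 := ⟨k - 1, by omega⟩
  obtain ⟨M, hM⟩ : ∃ M, M = 2 * a + 1 := ⟨_, rfl⟩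
  have hMa : (a : ℚ) = (M - 1) / 2 := by rw [hM]; push_cast; ring
  rw [show a + 1 + (a + 1) = M + 1 by omega, wiener_combArc_eq_sum (by omega) hne,
    sum_range_sum_range_eq, Finset.sum_add_distrib]
  have hpairs : ∑ c ∈ Finset.range n, ∑ d ∈ Finset.range c,
      ((∑ i ∈ Finset.range M, ∑ j ∈ Finset.range M, ratCombDist M n (i + 1) c (j + 1) d +
        ∑ i ∈ Finset.range M, ratCombDist M n (i + 1) c 0 d +
        ∑ j ∈ Finset.range M, ratCombDist M n 0 c (j + 1) d + ratCombDist M n 0 c 0 d) +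
      (∑ i ∈ Finset.range M, ∑ j ∈ Finset.range M, ratCombDist M n (i + 1) d (j + 1) c +
        ∑ i ∈ Finset.range M, ratCombDist M n (i + 1) d 0 c +
        ∑ j ∈ Finset.range M, ratCombDist M n 0 d (j + 1) c + ratCombDist M n 0 d 0 c)) =
      ∑ c ∈ Finset.range n, ∑ d ∈ Finset.range c,
        ((M * ((M - 1) / 2 + 1) - M * (M - 1) / 2 + M * (n + (n - 1) * M) + M * (M - 1) / 2 +
          n + (n - 1) * M + (M - 1) / 2 + 1 + M * (M ^ 2 - 1) / 3 + 4 + M * (M + 1) / 2 +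
          M * (n + (n - 1) * M) + M * (M - 1) / 2 : ℚ) + (M ^ 3 + M ^ 2) * c +
          -((M : ℚ) + 1) ^ 3 * d + ((M - 1) / 2 * (M + 1)) * (-1) ^ d -
          if c = d + 1 then 2 else 0) := by
    refine Finset.sum_congr rfl fun c _ => Finset.sum_congr rfl fun d hd => ?_
    have hd := Finset.mem_range.1 hd
    rw [sum_ratCombDist_succ_succ_of_lt hd, sum_ratCombDist_succ_zero_of_lt hd,
      sum_ratCombDist_zero_succ, ratCombDist_zero_zero_of_lt hd,
      sum_ratCombDist_succ_succ_of_gt (by omega) hd, sum_ratCombDist_succ_zero_of_gt hd,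
      sum_ratCombDist_zero_succ, ratCombDist_zero_zero_of_le hd.le]
    ring
  have hdiag : ∑ c ∈ Finset.range n,
      (∑ i ∈ Finset.range M, ∑ j ∈ Finset.range M, ratCombDist M n (i + 1) c (j + 1) c +
        ∑ i ∈ Finset.range M, ratCombDist M n (i + 1) c 0 c +
        ∑ j ∈ Finset.range M, ratCombDist M n 0 c (j + 1) c + ratCombDist M n 0 c 0 c) =
      n * (((M + 1) * M ^ 2 - M * (M + 1) + (M - 1) * (M + 1) / 2) / 2) +
      2 * (((M * (M ^ 2 - 1) / 3 + M ^ 3 + M ^ 2) / 2 - M ^ 2 + M * (M - 1) / 2) -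
        ((M + 1) * M ^ 2 - M * (M + 1) + (M - 1) * (M + 1) / 2) / 2) +
      n * M * (M + 1) / 2 + (M - 1) * n + (M * (M + 1) - 2 * (M - 1)) +
      M * (n * n - n * (n - 1) / 2 + (n * (n - 1) - n * (n - 1) / 2) * M) +
      n * M * (M - 1) / 2 := by
    have hn2 : 2 ≤ n := by
      obtain ⟨j, hj⟩ := hne
      omega
    have hends (c : ℕ) (X Y : ℚ) : (if c = 0 ∨ c + 1 = n then X else Y) =
        Y + (if c = 0 then X - Y else 0) + if c = n - 1 then X - Y else 0 := by
      split_ifs <;> first | omega | ring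
    rw [Finset.sum_congr rfl fun c hc => by
      rw [sum_ratCombDist_succ_succ_self hM,
        sum_ratCombDist_succ_zero_self (by omega) hne (Finset.mem_range.1 hc),
        sum_ratCombDist_zero_succ, ratCombDist_zero_zero_of_le le_rfl, hends]]
    simp only [Finset.sum_sub_distrib, Finset.sum_add_distrib, ← Finset.mul_sum, sum_range_cast,
      sum_range_neg_one_pow, Finset.sum_const, Finset.card_range, nsmul_eq_mul, ← Finset.sum_mul,
      Finset.sum_ite_eq', if_pos (Finset.mem_range.2 (show n - 1 < n by omega)),
      if_pos (Finset.mem_range.2 (show 0 < n by omega)), hne.neg_one_pow]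
    rw [hMa]
    ring
  rw [hpairs, hdiag, show n = (n - 1) + 1 by omega, sum_range_sum_range_lt]
  rw [Nat.sub_add_cancel (show 1 ≤ n by omega), hne.neg_one_pow, Nat.cast_sub (by omega)]
  push_cast
  ring

/-- Theorem 5: if `m` and `n` are even with `4 ≤ m < n`, then the comb orientation of
the `m × n` grid has strictly larger Wiener index than that of the `n × m` grid. -/
theorem wiener_comb_mn_gt_nm (m n : ℕ) (hm : Even m) (hn : Even n)
    (hm4 : 4 ≤ m) (hmn : m < n) :
    wiener (CombArc m n) > wiener (CombArc n m) := by
  rw [gt_iff_lt, ← Nat.cast_lt (α := ℚ), wiener_combArc_eq hm hn hm4 (by omega),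
    wiener_combArc_eq hn hm (by omega) (by omega)]
  obtain ⟨x, rfl⟩ := Nat.exists_eq_add_of_le hm4
  obtain ⟨y, rfl⟩ := Nat.exists_eq_add_of_lt hmn
  have hy : 1 ≤ y := by
    by_contra! h
    obtain ⟨i, hi⟩ := hm
    obtain ⟨j, hj⟩ := hn
    omega
  obtain ⟨z, rfl⟩ := Nat.exists_eq_add_of_le hy
  rw [← sub_pos]
  push_cast
  ring_nf
  positivity
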